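/- (Pointwise tail bound; the key estimate behind Theorem 4.) Let N ≥ 2, let h_1, …, h_N : ℝⁿ → ℝ be differentiable, let F : ℝⁿ → ℝⁿ, and fix x ∈ ℝⁿ, θ > 0 and constants r_∞ > 0, K ≥ 0, g > 0. Suppose that: (i) for every active index i ∈ A(x), L_F h_i(x) ≥ r_∞; (ii) for every inactive index j ∈ P(x), δ_j(x) ≥ g and |L_F h_j(x)| ≤ K. Then L_F h̃_θ(x) ≥ r_∞ − (N−1)·(r_∞ + K)·e^{−θ g}. In particular L_F h̃_θ(x) > 0 whenever θ > (1/g)·log( (N−1)(r_∞ + K) / r_∞ ). -/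

import Mathlib

/-- The pointwise minimum `ĥ(x) = min_{1 ≤ i ≤ N} h_i(x)`. -/
noncomputable def hmin {n N : ℕ} (hN : 0 < N) (h : Fin N → (Fin n → ℝ) → ℝ)
    (x : Fin n → ℝ) : ℝ :=
  Finset.univ.inf' (Finset.univ_nonempty_iff.mpr ⟨⟨0, hN⟩⟩) fun i => h i x

/-- The soft-min (log-sum-exp) `h̃_θ(x) = -(1/θ) log (∑ i, exp (-θ h_i x))`. -/
noncomputable def softmin {n N : ℕ} (θ : ℝ) (h : Fin N → (Fin n → ℝ) → ℝ)
    (x : Fin n → ℝ) : ℝ :=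
  -(1 / θ) * Real.log (∑ i, Real.exp (-θ * h i x))

/-- The Lie derivative `L_F g(x) = D g(x)(F(x))` of `g` along the vector field `F`. -/
noncomputable def lieD {n : ℕ} (F : (Fin n → ℝ) → (Fin n → ℝ)) (g : (Fin n → ℝ) → ℝ)
    (x : Fin n → ℝ) : ℝ :=
  fderiv ℝ g x (F x)

/-- The Lie derivative of the soft-min is the softmax-weighted average of the Lie derivatives. -/
lemma lieD_softmin {n N : ℕ} [NeZero N] {θ : ℝ} (hθ : θ ≠ 0)
    {h : Fin N → (Fin n → ℝ) → ℝ} {x : Fin n → ℝ} (hdiff : ∀ i, DifferentiableAt ℝ (h i) x)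
    (F : (Fin n → ℝ) → (Fin n → ℝ)) :
    lieD F (softmin θ h) x =
      (∑ i, Real.exp (-θ * h i x) * lieD F (h i) x) / ∑ i, Real.exp (-θ * h i x) := by
  have hS : 0 < ∑ i, Real.exp (-θ * h i x) :=
    Finset.sum_pos (fun i _ => Real.exp_pos _) Finset.univ_nonempty
  have hD : HasFDerivAt (softmin θ h) _ x :=
    ((HasFDerivAt.fun_sum fun i (_ : i ∈ Finset.univ) =>
      ((hdiff i).hasFDerivAt.const_mul (-θ)).exp).log hS.ne').const_mul (-(1 / θ))
  have hsum : ∑ i, Real.exp (-θ * h i x) * (-θ * fderiv ℝ (h i) x (F x)) =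
      -θ * ∑ i, Real.exp (-θ * h i x) * fderiv ℝ (h i) x (F x) := by
    rw [Finset.mul_sum]
    exact Finset.sum_congr rfl fun i _ => by ring
  unfold lieD
  rw [hD.fderiv]
  simp only [smul_apply, sum_apply, smul_eq_mul]
  rw [hsum]
  field_simp

/-- If one term of a sum over `Fin N` is nonnegative and all terms are at least `-c`, then the sum
is at least `-(N - 1) c`. -/
lemma neg_mul_le_sum_of_nonneg_of_neg_le {N : ℕ} {f : Fin N → ℝ} {c : ℝ} {k : Fin N}
    (hk : 0 ≤ f k) (hf : ∀ i, -c ≤ f i) : -(((N : ℝ) - 1) * c) ≤ ∑ i, f i := by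
  have hcard := Finset.card_nsmul_le_sum (Finset.univ.erase k) f (-c) fun i _ => hf i
  rw [Finset.card_erase_of_mem (Finset.mem_univ k), Finset.card_fin, nsmul_eq_mul,
    Nat.cast_pred k.pos] at hcard
  rw [← Finset.add_sum_erase _ _ (Finset.mem_univ k)]
  linarith

/-- pointwise tail bound: with active indices `i` (those with
`h_i(x) = ĥ(x)`) satisfying `L_F h_i(x) ≥ r_∞`, and inactive indices `j` satisfying
`δ_j(x) ≥ g` and `|L_F h_j(x)| ≤ K`, one has
`L_F h̃_θ(x) ≥ r_∞ - (N-1)(r_∞+K) e^{-θg}`; in particular `L_F h̃_θ(x) > 0` whenever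
`θ > (1/g) log ((N-1)(r_∞+K)/r_∞)`. -/
theorem softmin_tail_bound {n N : ℕ} (hN2 : 2 ≤ N)
    (h : Fin N → (Fin n → ℝ) → ℝ) (hdiff : ∀ i, Differentiable ℝ (h i))
    (F : (Fin n → ℝ) → (Fin n → ℝ)) (x : Fin n → ℝ)
    (θ rinf K g : ℝ) (hθ : 0 < θ) (hrinf : 0 < rinf) (hK : 0 ≤ K) (hg : 0 < g)
    (hactive : ∀ i, h i x = hmin (by omega : 0 < N) h x → rinf ≤ lieD F (h i) x)
    (hinactive : ∀ j, h j x ≠ hmin (by omega : 0 < N) h x →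
      g ≤ h j x - hmin (by omega : 0 < N) h x ∧ |lieD F (h j) x| ≤ K) :
    rinf - ((N : ℝ) - 1) * (rinf + K) * Real.exp (-θ * g) ≤ lieD F (softmin θ h) x ∧
    ((1 / g) * Real.log (((N : ℝ) - 1) * (rinf + K) / rinf) < θ →
      0 < lieD F (softmin θ h) x) := by
  have hN : 0 < N := by omega
  have : NeZero N := ⟨hN.ne'⟩
  have hN1 : (0 : ℝ) < (N : ℝ) - 1 := by
    have : (2 : ℝ) ≤ N := by exact_mod_cast hN2
    linarith
  have hbound : rinf - ((N : ℝ) - 1) * (rinf + K) * Real.exp (-θ * g) ≤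
      lieD F (softmin θ h) x := by
    obtain ⟨k, -, hk⟩ := Finset.exists_mem_eq_inf'
      (Finset.univ_nonempty_iff.mpr ⟨⟨0, hN⟩⟩) fun i => h i x
    have hkmin : h k x = hmin hN h x := hk.symm
    have hS : 0 < ∑ i, Real.exp (-θ * h i x) :=
      Finset.sum_pos (fun i _ => Real.exp_pos _) Finset.univ_nonempty
    have hkS : Real.exp (-θ * h k x) ≤ ∑ i, Real.exp (-θ * h i x) :=
      Finset.single_le_sum (f := fun i => Real.exp (-θ * h i x))
        (fun i _ => (Real.exp_pos _).le) (Finset.mem_univ k)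
    have hnonneg : ∀ i, h i x = hmin hN h x →
        0 ≤ Real.exp (-θ * h i x) * (lieD F (h i) x - rinf) := fun i hi =>
      mul_nonneg (Real.exp_pos _).le (sub_nonneg.2 (hactive i hi))
    have hterm : ∀ i, -((rinf + K) * (Real.exp (-θ * g) * Real.exp (-θ * h k x))) ≤
        Real.exp (-θ * h i x) * (lieD F (h i) x - rinf) := by
      intro i
      by_cases hi : h i x = hmin hN h x
      · exact (neg_nonpos.2 (by positivity)).trans (hnonneg i hi)
      · obtain ⟨hgap, hL⟩ := hinactive i hi
        rw [← hkmin] at hgap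
        have hexp : Real.exp (-θ * h i x) ≤ Real.exp (-θ * g) * Real.exp (-θ * h k x) := by
          rw [← Real.exp_add, Real.exp_le_exp]
          nlinarith
        have hlow : -(rinf + K) ≤ lieD F (h i) x - rinf := by linarith [(abs_le.1 hL).1]
        calc -((rinf + K) * (Real.exp (-θ * g) * Real.exp (-θ * h k x)))
            ≤ -((rinf + K) * Real.exp (-θ * h i x)) := by gcongr
          _ = Real.exp (-θ * h i x) * -(rinf + K) := by ring
          _ ≤ _ := by gcongr
    have hsum := neg_mul_le_sum_of_nonneg_of_neg_le (hnonneg k hkmin) hterm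
    simp only [mul_sub, Finset.sum_sub_distrib, ← Finset.sum_mul] at hsum
    have hscale := mul_le_mul_of_nonneg_left hkS
      (by positivity : 0 ≤ ((N : ℝ) - 1) * (rinf + K) * Real.exp (-θ * g))
    rw [lieD_softmin hθ.ne' fun i => hdiff i x, le_div_iff₀ hS]
    linarith
  refine ⟨hbound, fun hlog => lt_of_lt_of_le ?_ hbound⟩
  have hc : 0 < ((N : ℝ) - 1) * (rinf + K) / rinf := by positivity
  rw [one_div, inv_mul_lt_iff₀ hg, Real.log_lt_iff_lt_exp hc, div_lt_iff₀ hrinf] at hlog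
  rw [sub_pos, neg_mul, Real.exp_neg, ← div_eq_mul_inv, div_lt_iff₀ (Real.exp_pos _),
    mul_comm θ g, mul_comm rinf]
  exact hlog
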